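/- Fix α ∈ (0,1] and T ∈ ℕ. Draw h_1,…,h_T i.i.d. uniform on the unit circle in ℝ², draw ε_1,…,ε_T i.i.d. uniform on {−1,+1} independently, and set c_t = α·h_t + ε_t·√(1−α²)·R h_t, where R is rotation by π/2. Consider any deterministic algorithm for online linear optimization with hints on the unit ball of ℝ²: at each round t it decides whether to query, as a function of (c_1,…,c_{t−1}) and the hints received in previous query rounds, and then plays x_t with ‖x_t‖ ≤ 1 as a function of that history together with h_t if it queried. If the algorithm makes at most K queries on every input, then there is a universal constant κ > 0 such that its expected regret satisfies E[ Σ_{t=1}^T ⟨c_t, x_t⟩ + ‖Σ_{t=1}^T c_t‖ ] ≥ κ·√T − K·α. -/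

import Mathlib

open RealInnerProductSpace MeasureTheory

/-- Points of `ℝ²` with the Euclidean structure. -/
abbrev E2 := EuclideanSpace ℝ (Fin 2)

/-- The history observed by a hint-querying online algorithm after `t` rounds: the list of
pairs (cost vector, hint received at that round if it was queried). -/
def histOf {β : Type*} (query : List (β × Option β) → Bool)
    (cs hs : ℕ → β) : ℕ → List (β × Option β)
  | 0 => []
  | t + 1 =>
      histOf query cs hs t ++
        [(cs t, if query (histOf query cs hs t) then some (hs t) else none)]

/-- The hint observed at round `t`: `some (hs t)` if the algorithm queries, `none` otherwise. -/
def obsHint {β : Type*} (query : List (β × Option β) → Bool)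
    (cs hs : ℕ → β) (t : ℕ) : Option β :=
  if query (histOf query cs hs t) then some (hs t) else none

/-- The point played at round `t` by the deterministic algorithm `(query, play)`. -/
def playOf {β : Type*} (query : List (β × Option β) → Bool)
    (play : List (β × Option β) → Option β → β) (cs hs : ℕ → β) (t : ℕ) : β :=
  play (histOf query cs hs t) (obsHint query cs hs t)

/-- The unit vector of angle `θ` on the unit circle. -/
noncomputable def hvec (θ : ℝ) : E2 :=
  (WithLp.equiv 2 (Fin 2 → ℝ)).symm ![Real.cos θ, Real.sin θ]

/-- `hvec θ` rotated by `π/2`. -/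
noncomputable def rvec (θ : ℝ) : E2 :=
  (WithLp.equiv 2 (Fin 2 → ℝ)).symm ![-Real.sin θ, Real.cos θ]

/-- The random cost vector `c = α·h ± √(1−α²)·Rh` built from the hint of angle `θ` and the
random sign `ε`. -/
noncomputable def cvec (α θ : ℝ) (ε : Bool) : E2 :=
  α • hvec θ + ((if ε then (1 : ℝ) else -1) * Real.sqrt (1 - α ^ 2)) • rvec θ

/-- Extend a finite input `ω : Fin T → γ` to `ℕ → γ` (by a default value beyond `T`). -/
def liftSeq {γ : Type*} [Inhabited γ] {T : ℕ} (ω : Fin T → γ) : ℕ → γ :=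
  fun t => if h : t < T then ω ⟨t, h⟩ else default

/-- The sequence of hints determined by the random angles. -/
noncomputable def hseqF {T : ℕ} (ω : Fin T → ℝ × Bool) : ℕ → E2 :=
  fun t => hvec (liftSeq ω t).1

/-- The sequence of cost vectors determined by the random angles and signs. -/
noncomputable def cseqF (α : ℝ) {T : ℕ} (ω : Fin T → ℝ × Bool) : ℕ → E2 :=
  fun t => cvec α (liftSeq ω t).1 (liftSeq ω t).2

/-- The distribution of one round of randomness: a uniform angle in `(0, 2π]` (giving a
uniform hint direction on the unit circle) together with an independent uniform sign. -/
noncomputable def roundMeasure : Measure (ℝ × Bool) :=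
  ((ENNReal.ofReal (2 * Real.pi))⁻¹ •
      volume.restrict (Set.Ioc 0 (2 * Real.pi))).prod
    ((PMF.uniformOfFintype Bool).toMeasure)

/-- The product distribution of the `T` i.i.d. rounds of randomness. -/
noncomputable def inputMeasure (T : ℕ) : Measure (Fin T → ℝ × Bool) :=
  Measure.pi fun _ : Fin T => roundMeasure

instance : IsProbabilityMeasure roundMeasure := by
  unfold roundMeasure
  have h : IsProbabilityMeasure ((ENNReal.ofReal (2 * Real.pi))⁻¹ •
      (volume : Measure ℝ).restrict (Set.Ioc 0 (2 * Real.pi))) := by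
    constructor
    have hpos : ENNReal.ofReal (2 * Real.pi) ≠ 0 := by
      simp [Real.pi_pos]
    simp only [Measure.smul_apply, Measure.restrict_apply_univ, Real.volume_Ioc, sub_zero,
      smul_eq_mul]
    exact ENNReal.inv_mul_cancel hpos ENNReal.ofReal_ne_top
  infer_instance

instance (T : ℕ) : IsProbabilityMeasure (inputMeasure T) := by
  unfold inputMeasure
  infer_instance

/-- Resampling one coordinate preserves a product of probability measures. -/
theorem measurePreserving_update_pi {ι γ : Type*} [Fintype ι] [DecidableEq ι]
    [MeasurableSpace γ] (μ : Measure γ) [IsProbabilityMeasure μ] (i : ι) :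
    MeasurePreserving (fun p : (ι → γ) × γ => Function.update p.1 i p.2)
      ((Measure.pi fun _ : ι => μ).prod μ) (Measure.pi fun _ : ι => μ) := by
  have hm : Measurable (fun p : (ι → γ) × γ => Function.update p.1 i p.2) := by
    refine measurable_pi_lambda _ fun j => ?_
    by_cases hj : j = i
    · subst hj
      simpa using measurable_snd
    · simp only [Function.update_of_ne hj]
      exact (measurable_pi_apply j).comp measurable_fst
  refine ⟨hm, (Measure.pi_eq fun s hs => ?_).symm⟩
  have hpre : (fun p : (ι → γ) × γ => Function.update p.1 i p.2) ⁻¹' (Set.univ.pi s) =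
      (Set.univ.pi (Function.update s i Set.univ)) ×ˢ s i := by
    ext ⟨f, y⟩
    simp only [Set.mem_preimage, Set.mem_pi, Set.mem_univ, true_implies, Set.mem_prod]
    constructor
    · intro h
      refine ⟨fun j => ?_, by simpa using h i⟩
      by_cases hj : j = i
      · subst hj; simp
      · simpa [Function.update_of_ne hj] using h j
    · rintro ⟨h, hy⟩ j
      by_cases hj : j = i
      · subst hj; simpa using hy
      · simpa [Function.update_of_ne hj] using h j
  rw [Measure.map_apply hm (MeasurableSet.univ_pi hs), hpre, Measure.prod_prod, Measure.pi_pi,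
    ← Finset.mul_prod_erase _ _ (Finset.mem_univ i),
    ← Finset.mul_prod_erase (Finset.univ) (fun j => μ (s j)) (Finset.mem_univ i)]
  have hrest : ∏ j ∈ Finset.univ.erase i, μ (Function.update s i Set.univ j) =
      ∏ j ∈ Finset.univ.erase i, μ (s j) :=
    Finset.prod_congr rfl fun j hj => by rw [Function.update_of_ne (Finset.ne_of_mem_erase hj)]
  rw [hrest]
  simp [mul_comm]

theorem integrable_update_pi {ι γ : Type*} [Fintype ι] [DecidableEq ι]
    [MeasurableSpace γ] (μ : Measure γ) [IsProbabilityMeasure μ] (i : ι) {f : (ι → γ) → ℝ}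
    (hf : Integrable f (Measure.pi fun _ : ι => μ)) :
    Integrable (fun ω => ∫ y, f (Function.update ω i y) ∂μ) (Measure.pi fun _ : ι => μ) :=
  ((measurePreserving_update_pi μ i).integrable_comp_of_integrable hf).integral_prod_left

theorem integral_update_pi {ι γ : Type*} [Fintype ι] [DecidableEq ι]
    [MeasurableSpace γ] (μ : Measure γ) [IsProbabilityMeasure μ] (i : ι) {f : (ι → γ) → ℝ}
    (hf : Integrable f (Measure.pi fun _ : ι => μ)) :
    ∫ ω, f ω ∂(Measure.pi fun _ : ι => μ) =
      ∫ ω, ∫ y, f (Function.update ω i y) ∂μ ∂(Measure.pi fun _ : ι => μ) := by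
  have hp := measurePreserving_update_pi μ i
  rw [← integral_prod (fun p : (ι → γ) × γ => f (Function.update p.1 i p.2))
    (hp.integrable_comp_of_integrable hf)]
  conv_lhs => rw [← hp.map_eq]
  exact integral_map hp.measurable.aemeasurable (by rw [hp.map_eq]; exact hf.1)

theorem integral_roundMeasure {f : ℝ × Bool → ℝ} (hf : Integrable f roundMeasure) :
    ∫ y, f y ∂roundMeasure =
      (2 * Real.pi)⁻¹ * ∫ θ in 0..(2 * Real.pi), (f (θ, true) + f (θ, false)) / 2 := by
  unfold roundMeasure at hf ⊢
  rw [integral_prod _ hf, integral_smul_measure,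
    intervalIntegral.integral_of_le (by positivity), smul_eq_mul, ENNReal.toReal_inv,
    ENNReal.toReal_ofReal (by positivity)]
  congr 2
  ext θ
  rw [PMF.integral_eq_sum]
  simp
  ring

theorem norm_hvec (θ : ℝ) : ‖hvec θ‖ = 1 := by
  simp [hvec, EuclideanSpace.norm_eq]

theorem continuous_hvec : Continuous hvec := by
  refine (PiLp.continuous_toLp 2 _).comp (continuous_pi fun i => ?_)
  fin_cases i <;> simp <;> fun_prop

theorem continuous_rvec : Continuous rvec := by
  refine (PiLp.continuous_toLp 2 _).comp (continuous_pi fun i => ?_)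
  fin_cases i <;> simp <;> fun_prop

theorem norm_cvec {α : ℝ} (hα : 0 < α) (hα1 : α ≤ 1) (θ : ℝ) (ε : Bool) :
    ‖cvec α θ ε‖ = 1 := by
  have h1 : Real.sqrt (1 - α ^ 2) ^ 2 = 1 - α ^ 2 := Real.sq_sqrt (by nlinarith)
  rw [EuclideanSpace.norm_eq, Real.sqrt_eq_one]
  have h2 := Real.sin_sq_add_cos_sq θ
  cases ε <;> simp [cvec, hvec, rvec, Fin.sum_univ_two] <;> grind

theorem measurable_cvec (α : ℝ) : Measurable fun p : ℝ × Bool => cvec α p.1 p.2 := by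
  refine measurable_from_prod_countable_left fun ε => Continuous.measurable ?_
  exact (continuous_hvec.const_smul α).add
    (continuous_rvec.const_smul ((if ε then (1 : ℝ) else -1) * Real.sqrt (1 - α ^ 2)))

theorem cvec_add_cvec (α θ : ℝ) : cvec α θ true + cvec α θ false = (2 * α) • hvec θ := by
  simp only [cvec, if_true, Bool.false_eq_true, if_false]
  module

theorem integral_inner_hvec (x : E2) : ∫ θ in 0..(2 * Real.pi), ⟪hvec θ, x⟫ = 0 := by
  simp [hvec, PiLp.inner_apply, Fin.sum_univ_two]

theorem integral_inner_cvec {α : ℝ} (hα : 0 < α) (hα1 : α ≤ 1) (x : E2) :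
    ∫ y, ⟪cvec α y.1 y.2, x⟫ ∂roundMeasure = 0 := by
  have hint : Integrable (fun y : ℝ × Bool => ⟪cvec α y.1 y.2, x⟫) roundMeasure := by
    refine Integrable.of_bound ((measurable_cvec α).inner_const.aestronglyMeasurable) ‖x‖
      (.of_forall fun y => ?_)
    simpa [norm_cvec hα hα1] using norm_inner_le_norm (𝕜 := ℝ) (cvec α y.1 y.2) x
  rw [integral_roundMeasure hint]
  simp only [← inner_add_left, cvec_add_cvec, inner_smul_left, RCLike.conj_to_real,
    mul_div_right_comm, intervalIntegral.integral_const_mul, integral_inner_hvec, mul_zero]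

theorem neg_le_integral_inner_cvec {α : ℝ} (hα : 0 < α) (hα1 : α ≤ 1) {x : ℝ → E2}
    (hx : ∀ θ, ‖x θ‖ ≤ 1) (hm : Measurable fun y : ℝ × Bool => x y.1) :
    -α ≤ ∫ y, ⟪cvec α y.1 y.2, x y.1⟫ ∂roundMeasure := by
  have hint : Integrable (fun y : ℝ × Bool => ⟪cvec α y.1 y.2, x y.1⟫) roundMeasure := by
    refine Integrable.of_bound (((measurable_cvec α).inner hm).aestronglyMeasurable) 1
      (.of_forall fun y => ?_)
    exact (norm_inner_le_norm (𝕜 := ℝ) (cvec α y.1 y.2) (x y.1)).trans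
      (by simpa [norm_cvec hα hα1] using hx y.1)
  have hxm : Measurable x := hm.comp (measurable_id.prodMk (measurable_const (a := true)))
  have hhm : Measurable hvec := continuous_hvec.measurable
  have hle : ∀ θ, |α * ⟪hvec θ, x θ⟫| ≤ α := fun θ => by
    have h := (abs_real_inner_le_norm (hvec θ) (x θ)).trans (by simpa [norm_hvec] using hx θ)
    rw [abs_mul, abs_of_pos hα]
    exact mul_le_of_le_one_right hα.le h
  rw [integral_roundMeasure hint]
  simp only [← inner_add_left, cvec_add_cvec, inner_smul_left, RCLike.conj_to_real, mul_assoc,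
    mul_div_cancel_left₀ _ (two_ne_zero (α := ℝ))]
  have hmono : ∫ _ in 0..(2 * Real.pi), -α ≤ ∫ θ in 0..(2 * Real.pi), α * ⟪hvec θ, x θ⟫ := by
    refine intervalIntegral.integral_mono_on (by positivity) intervalIntegrable_const ?_
      fun θ _ => (abs_le.1 (hle θ)).1
    exact (intervalIntegrable_const (c := α)).mono_fun
      ((hhm.inner hxm).const_mul α).aestronglyMeasurable
      (.of_forall fun θ => by simpa only [Real.norm_eq_abs, abs_of_pos hα] using hle θ)
  rw [intervalIntegral.integral_const, smul_eq_mul, sub_zero] at hmono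
  rw [le_inv_mul_iff₀ (by positivity)]
  exact hmono

theorem liftSeq_update_self {γ : Type*} [Inhabited γ] {T : ℕ} (ω : Fin T → γ) (i : Fin T)
    (y : γ) : liftSeq (Function.update ω i y) i = y := by
  simp [liftSeq]

theorem liftSeq_update_of_ne {γ : Type*} [Inhabited γ] {T : ℕ} (ω : Fin T → γ) (i : Fin T)
    (y : γ) {s : ℕ} (hs : s ≠ i) : liftSeq (Function.update ω i y) s = liftSeq ω s := by
  unfold liftSeq
  split_ifs with h
  · rw [Function.update_of_ne]
    rintro rfl
    exact hs rfl
  · rfl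

theorem histOf_congr {β : Type*} (query : List (β × Option β) → Bool) {cs hs cs' hs' : ℕ → β}
    {t : ℕ} (hc : ∀ s < t, cs s = cs' s) (hh : ∀ s < t, hs s = hs' s) :
    histOf query cs hs t = histOf query cs' hs' t := by
  induction t with
  | zero => rfl
  | succ t ih =>
    simp only [histOf, ih (fun s hs => hc s (by omega)) (fun s hs => hh s (by omega)),
      hc t (by omega), hh t (by omega)]

theorem histOf_update (query : List (E2 × Option E2) → Bool) (α : ℝ) {T : ℕ}
    (ω : Fin T → ℝ × Bool) (i : Fin T) (y : ℝ × Bool) :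
    histOf query (cseqF α (Function.update ω i y)) (hseqF (Function.update ω i y)) i =
      histOf query (cseqF α ω) (hseqF ω) i :=
  histOf_congr query
    (fun s hs => by simp only [cseqF, liftSeq_update_of_ne ω i y hs.ne])
    (fun s hs => by simp only [hseqF, liftSeq_update_of_ne ω i y hs.ne])

theorem norm_cseqF {α : ℝ} (hα : 0 < α) (hα1 : α ≤ 1) {T : ℕ} (ω : Fin T → ℝ × Bool) (t : ℕ) :
    ‖cseqF α ω t‖ = 1 := norm_cvec hα hα1 _ _

theorem measurable_cseqF (α : ℝ) {T : ℕ} (t : ℕ) :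
    Measurable fun ω : Fin T → ℝ × Bool => cseqF α ω t := by
  unfold cseqF liftSeq
  split_ifs with h
  · exact (measurable_cvec α).comp (measurable_pi_apply _)
  · exact measurable_const

theorem integrable_inner_cseqF {α : ℝ} (hα : 0 < α) (hα1 : α ≤ 1) {T : ℕ} (t : ℕ)
    {x : (Fin T → ℝ × Bool) → E2} (hm : Measurable x) {C : ℝ} (hC : ∀ ω, ‖x ω‖ ≤ C) :
    Integrable (fun ω => ⟪cseqF α ω t, x ω⟫) (inputMeasure T) := by
  refine Integrable.of_bound (((measurable_cseqF α t).inner hm).aestronglyMeasurable) C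
    (.of_forall fun ω => ?_)
  exact (norm_inner_le_norm (𝕜 := ℝ) (cseqF α ω t) (x ω)).trans
    (by simpa [norm_cseqF hα hα1] using hC ω)

/-- A cost vector is orthogonal in mean to every bounded vector not depending on its round. -/
theorem integral_inner_cseqF {α : ℝ} (hα : 0 < α) (hα1 : α ≤ 1) {T : ℕ} (i : Fin T)
    {x : (Fin T → ℝ × Bool) → E2} (hm : Measurable x) {C : ℝ} (hC : ∀ ω, ‖x ω‖ ≤ C)
    (hx : ∀ ω y, x (Function.update ω i y) = x ω) :
    ∫ ω, ⟪cseqF α ω i, x ω⟫ ∂(inputMeasure T) = 0 := by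
  have hint := integrable_inner_cseqF hα hα1 i hm hC
  unfold inputMeasure at hint ⊢
  rw [integral_update_pi _ i hint]
  simp only [hx, cseqF, liftSeq_update_self, integral_inner_cvec hα hα1, integral_zero]

/-- The mean loss is at least `-Kα` for an algorithm making at most `K` queries. -/
theorem neg_le_integral_loss {T K : ℕ} {α : ℝ} (hα : 0 < α) (hα1 : α ≤ 1)
    {query : List (E2 × Option E2) → Bool} {play : List (E2 × Option E2) → Option E2 → E2}
    (hplay : ∀ l o, ‖play l o‖ ≤ 1)
    (hK : ∀ cs hs : ℕ → E2,
      ((Finset.range T).filter fun t => query (histOf query cs hs t) = true).card ≤ K)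
    (hm : ∀ t, t < T → Measurable fun ω : Fin T → ℝ × Bool =>
      playOf query play (cseqF α ω) (hseqF ω) t) :
    -((K : ℝ) * α) ≤ ∫ ω, ∑ t ∈ Finset.range T,
      ⟪cseqF α ω t, playOf query play (cseqF α ω) (hseqF ω) t⟫ ∂(inputMeasure T) := by
  have hint : ∀ t : Fin T, Integrable (fun ω : Fin T → ℝ × Bool =>
      ⟪cseqF α ω t, playOf query play (cseqF α ω) (hseqF ω) t⟫) (inputMeasure T) :=
    fun t => integrable_inner_cseqF hα hα1 t (hm t t.2) (fun ω => hplay _ _)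
  simp only [Finset.sum_range]
  rw [integral_finsetSum _ fun t _ => hint t]
  unfold inputMeasure at hint ⊢
  simp_rw [fun t : Fin T => integral_update_pi _ t (hint t)]
  rw [← integral_finsetSum _ fun t _ => integrable_update_pi _ t (hint t)]
  have hround : ∀ (ω : Fin T → ℝ × Bool) (t : Fin T),
      (if query (histOf query (cseqF α ω) (hseqF ω) t) = true then -α else 0) ≤
      ∫ y, ⟪cseqF α (Function.update ω t y) t, playOf query play
        (cseqF α (Function.update ω t y)) (hseqF (Function.update ω t y)) t⟫ ∂roundMeasure := by
    intro ω t
    have hmt : Measurable fun y => playOf query play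
        (cseqF α (Function.update ω t y)) (hseqF (Function.update ω t y)) t :=
      (hm t t.2).comp (measurable_update ω)
    simp only [playOf, obsHint, histOf_update] at hmt ⊢
    split_ifs with hq
    · simp only [hq, if_true, hseqF, cseqF, liftSeq_update_self] at hmt ⊢
      exact neg_le_integral_inner_cvec hα hα1
        (x := fun θ => play (histOf query (cseqF α ω) (hseqF ω) t) (some (hvec θ)))
        (fun θ => hplay _ _) hmt
    · simp only [cseqF, liftSeq_update_self]
      exact (integral_inner_cvec hα hα1 _).ge
  have hsum : ∀ ω : Fin T → ℝ × Bool, -((K : ℝ) * α) ≤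
      ∑ t : Fin T, ∫ y, ⟪cseqF α (Function.update ω t y) t, playOf query play
        (cseqF α (Function.update ω t y)) (hseqF (Function.update ω t y)) t⟫ ∂roundMeasure := by
    intro ω
    refine le_trans ?_ (Finset.sum_le_sum fun t _ => hround ω t)
    rw [← Finset.sum_range
      (fun t => if query (histOf query (cseqF α ω) (hseqF ω) t) = true then -α else 0),
      ← Finset.sum_filter, Finset.sum_const, nsmul_eq_mul, mul_neg, neg_le_neg_iff]
    gcongr
    exact hK _ _
  calc -((K : ℝ) * α) = ∫ _, -((K : ℝ) * α) ∂(Measure.pi fun _ : Fin T => roundMeasure) := by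
        simp
    _ ≤ _ := integral_mono (integrable_const _)
        (integrable_finsetSum _ fun t _ => integrable_update_pi _ t (hint t)) hsum

theorem norm_sum_cseqF_le {α : ℝ} (hα : 0 < α) (hα1 : α ≤ 1) {T : ℕ} (ω : Fin T → ℝ × Bool)
    (n : ℕ) : ‖∑ t ∈ Finset.range n, cseqF α ω t‖ ≤ n :=
  (norm_sum_le _ _).trans (by simp [norm_cseqF hα hα1])

theorem measurable_sum_cseqF (α : ℝ) {T : ℕ} (n : ℕ) :
    Measurable fun ω : Fin T → ℝ × Bool => ∑ t ∈ Finset.range n, cseqF α ω t :=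
  Finset.measurable_fun_sum _ fun t _ => measurable_cseqF α t

theorem sum_cseqF_update (α : ℝ) {T : ℕ} (ω : Fin T → ℝ × Bool) (i : Fin T) (y : ℝ × Bool) :
    ∑ t ∈ Finset.range i, cseqF α (Function.update ω i y) t =
      ∑ t ∈ Finset.range i, cseqF α ω t :=
  Finset.sum_congr rfl fun t ht => by
    simp only [cseqF, liftSeq_update_of_ne ω i y (Finset.mem_range.1 ht).ne]

theorem integrable_norm_sum_pow {α : ℝ} (hα : 0 < α) (hα1 : α ≤ 1) {T : ℕ} (n k : ℕ) :
    Integrable (fun ω : Fin T → ℝ × Bool => ‖∑ t ∈ Finset.range n, cseqF α ω t‖ ^ k)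
      (inputMeasure T) := by
  refine Integrable.of_bound
    ((measurable_sum_cseqF α n).norm.pow_const k).aestronglyMeasurable ((n : ℝ) ^ k)
    (.of_forall fun ω => ?_)
  rw [norm_pow, norm_norm]
  gcongr
  exact norm_sum_cseqF_le hα hα1 ω n

theorem integral_norm_sum_sq {α : ℝ} (hα : 0 < α) (hα1 : α ≤ 1) {T n : ℕ} (hn : n ≤ T) :
    ∫ ω : Fin T → ℝ × Bool, ‖∑ t ∈ Finset.range n, cseqF α ω t‖ ^ 2 ∂(inputMeasure T) = n := by
  induction n with
  | zero => simp
  | succ n ih =>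
    have hmean := integral_inner_cseqF hα hα1 (⟨n, hn⟩ : Fin T) (measurable_sum_cseqF α n)
      (fun ω => norm_sum_cseqF_le hα hα1 ω n) (fun ω y => sum_cseqF_update α ω ⟨n, hn⟩ y)
    have hint := integrable_inner_cseqF hα hα1 n (measurable_sum_cseqF (T := T) α n)
      (fun ω => norm_sum_cseqF_le hα hα1 ω n)
    have hexp : ∀ ω : Fin T → ℝ × Bool, ‖∑ t ∈ Finset.range (n + 1), cseqF α ω t‖ ^ 2 =
        ‖∑ t ∈ Finset.range n, cseqF α ω t‖ ^ 2 +
          2 * ⟪cseqF α ω n, ∑ t ∈ Finset.range n, cseqF α ω t⟫ + 1 := by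
      intro ω
      rw [Finset.sum_range_succ, norm_add_sq_real, norm_cseqF hα hα1, real_inner_comm]
      ring
    simp only [hexp]
    rw [integral_add ((integrable_norm_sum_pow hα hα1 n 2).fun_add (hint.const_mul 2))
      (integrable_const _), integral_add (integrable_norm_sum_pow hα hα1 n 2)
      (hint.const_mul 2), integral_const_mul, hmean, ih (by omega)]
    simp

theorem integral_norm_sum_pow_four_le {α : ℝ} (hα : 0 < α) (hα1 : α ≤ 1) {T n : ℕ}
    (hn : n ≤ T) :
    ∫ ω : Fin T → ℝ × Bool, ‖∑ t ∈ Finset.range n, cseqF α ω t‖ ^ 4 ∂(inputMeasure T) ≤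
      3 * (n : ℝ) ^ 2 := by
  induction n with
  | zero => simp
  | succ n ih =>
    set S : (Fin T → ℝ × Bool) → E2 := fun ω => ∑ t ∈ Finset.range n, cseqF α ω t with hS
    have hSm : Measurable S := measurable_sum_cseqF α n
    have hSb : ∀ ω, ‖S ω‖ ≤ n := fun ω => norm_sum_cseqF_le hα hα1 ω n
    set X : (Fin T → ℝ × Bool) → E2 := fun ω => (4 * (‖S ω‖ ^ 2 + 1)) • S ω with hX
    have hXm : Measurable X := (((hSm.norm.pow_const 2).add_const 1).const_mul 4).smul hSm
    have hXb : ∀ ω, ‖X ω‖ ≤ 4 * ((n : ℝ) ^ 2 + 1) * n := by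
      intro ω
      rw [hX, norm_smul, Real.norm_of_nonneg (by positivity)]
      gcongr <;> exact hSb ω
    have hmean := integral_inner_cseqF hα hα1 (⟨n, hn⟩ : Fin T) hXm hXb
      (fun ω y => by simp only [hX, hS, sum_cseqF_update α ω ⟨n, hn⟩ y])
    have hint := integrable_inner_cseqF hα hα1 n hXm hXb
    have hle : ∀ ω : Fin T → ℝ × Bool, ‖∑ t ∈ Finset.range (n + 1), cseqF α ω t‖ ^ 4 ≤
        ‖S ω‖ ^ 4 + 6 * ‖S ω‖ ^ 2 + ⟪cseqF α ω n, X ω⟫ + 1 := by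
      intro ω
      have hsq : ‖∑ t ∈ Finset.range (n + 1), cseqF α ω t‖ ^ 2 =
          ‖S ω‖ ^ 2 + 2 * ⟪cseqF α ω n, S ω⟫ + 1 := by
        rw [Finset.sum_range_succ, norm_add_sq_real, norm_cseqF hα hα1, real_inner_comm]
        ring
      have hcs : ⟪cseqF α ω n, S ω⟫ ^ 2 ≤ ‖S ω‖ ^ 2 := by
        rw [sq_le_sq, abs_norm]
        simpa [norm_cseqF hα hα1] using abs_real_inner_le_norm (cseqF α ω n) (S ω)
      have hXi : ⟪cseqF α ω n, X ω⟫ = 4 * (‖S ω‖ ^ 2 + 1) * ⟪cseqF α ω n, S ω⟫ :=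
        real_inner_smul_right _ _ _
      rw [show ∀ a : ℝ, a ^ 4 = (a ^ 2) ^ 2 by intro a; ring, hsq, hXi]
      nlinarith
    have i4 : Integrable (fun ω => ‖S ω‖ ^ 4) (inputMeasure T) :=
      integrable_norm_sum_pow hα hα1 n 4
    have i2 : Integrable (fun ω => 6 * ‖S ω‖ ^ 2) (inputMeasure T) :=
      (integrable_norm_sum_pow hα hα1 n 2).const_mul 6
    refine (integral_mono (integrable_norm_sum_pow hα hα1 (n + 1) 4)
      (((i4.add i2).add hint).add (integrable_const 1)) hle).trans ?_
    have h2 := integral_norm_sum_sq hα hα1 (T := T) (n := n) (by omega)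
    have h4 := ih (by omega)
    have heq : ∫ ω, (‖S ω‖ ^ 4 + 6 * ‖S ω‖ ^ 2 + ⟪cseqF α ω n, X ω⟫ + 1) ∂(inputMeasure T) =
        ∫ ω, ‖S ω‖ ^ 4 ∂(inputMeasure T) + 6 * n + 0 + 1 := by
      rw [integral_add ((i4.fun_add i2).fun_add hint) (integrable_const _),
        integral_add (i4.fun_add i2) hint, integral_add i4 i2, integral_const_mul, h2, hmean]
      simp
    refine heq.le.trans ?_
    push_cast
    nlinarith

theorem le_integral_norm_sum {α : ℝ} (hα : 0 < α) (hα1 : α ≤ 1) (T : ℕ) :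
    1 / 4 * Real.sqrt T ≤
      ∫ ω : Fin T → ℝ × Bool, ‖∑ t ∈ Finset.range T, cseqF α ω t‖ ∂(inputMeasure T) := by
  rcases Nat.eq_zero_or_pos T with rfl | hT
  · simp
  set s := Real.sqrt T with hs
  have hs0 : 0 < s := Real.sqrt_pos.2 (by exact_mod_cast hT)
  have hs2 : (T : ℝ) = s ^ 2 := (Real.sq_sqrt (Nat.cast_nonneg T)).symm
  have hpt : ∀ x : ℝ, 0 ≤ x → s⁻¹ * x ^ 2 - (4 * s ^ 3)⁻¹ * x ^ 4 ≤ x := by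
    intro x hx
    obtain ⟨u, rfl⟩ : ∃ u, x = s * u := ⟨x / s, by field_simp⟩
    have hu : 0 ≤ u := nonneg_of_mul_nonneg_right hx hs0
    have he : s⁻¹ * (s * u) ^ 2 - (4 * s ^ 3)⁻¹ * (s * u) ^ 4 = s * (u ^ 2 - u ^ 4 / 4) := by
      field_simp
    rw [he]
    gcongr
    have : 0 ≤ 1 - u + u ^ 3 / 4 := by
      nlinarith [sq_nonneg (u - 1), mul_nonneg hu (sq_nonneg (u - 1))]
    nlinarith [mul_nonneg hu this]
  have i1 := integrable_norm_sum_pow hα hα1 (T := T) T 1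
  have i2 := (integrable_norm_sum_pow hα hα1 (T := T) T 2).const_mul s⁻¹
  have i4 := (integrable_norm_sum_pow hα hα1 (T := T) T 4).const_mul (4 * s ^ 3)⁻¹
  simp only [pow_one] at i1
  refine le_trans ?_ (integral_mono (i2.sub i4) i1 fun ω => hpt _ (norm_nonneg _))
  have h4 := integral_norm_sum_pow_four_le hα hα1 (le_refl T)
  have hmul := mul_le_mul_of_nonneg_left h4 (by positivity : (0 : ℝ) ≤ (4 * s ^ 3)⁻¹)
  have heq := integral_sub i2 i4
  rw [integral_const_mul, integral_const_mul, integral_norm_sum_sq hα hα1 (le_refl T)] at heq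
  refine le_trans ?_ heq.ge
  rw [hs2] at hmul ⊢
  have e1 : s⁻¹ * s ^ 2 = s := by field_simp
  have e2 : (4 * s ^ 3)⁻¹ * (3 * (s ^ 2) ^ 2) = 3 / 4 * s := by field_simp
  rw [e1]
  linarith

/-- Theorem 5.1: there is a universal constant `κ > 0` such that any
deterministic algorithm for OLO with hints on the unit ball of `ℝ²` making at most `K` hint
queries on every input has, on the random instance `c_t = α h_t ± √(1−α²)·Rh_t` with `h_t`
uniform on the circle, expected regret at least `κ√T − Kα`. -/
theorem stmt8 :
    ∃ κ : ℝ, 0 < κ ∧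
      ∀ (T K : ℕ) (α : ℝ), 0 < α → α ≤ 1 →
      ∀ (query : List (E2 × Option E2) → Bool)
        (play : List (E2 × Option E2) → Option E2 → E2),
        (∀ l o, ‖play l o‖ ≤ 1) →
        (∀ cs hs : ℕ → E2,
          ((Finset.range T).filter fun t =>
            query (histOf query cs hs t) = true).card ≤ K) →
        (∀ t, t < T → Measurable fun ω : Fin T → ℝ × Bool =>
          playOf query play (cseqF α ω) (hseqF ω) t) →
        κ * Real.sqrt T - (K : ℝ) * α ≤
          ∫ ω, (∑ t ∈ Finset.range T,
                ⟪cseqF α ω t, playOf query play (cseqF α ω) (hseqF ω) t⟫ +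
              ‖∑ t ∈ Finset.range T, cseqF α ω t‖) ∂(inputMeasure T) := by
  refine ⟨1 / 4, by norm_num, ?_⟩
  intro T K α hα hα1 query play hplay hK hm
  rw [integral_add]
  · linarith [neg_le_integral_loss hα hα1 hplay hK hm, le_integral_norm_sum hα hα1 T]
  · exact integrable_finsetSum _ fun t ht => integrable_inner_cseqF hα hα1 t
      (hm t (Finset.mem_range.1 ht)) (fun ω => hplay _ _)
  · simpa using integrable_norm_sum_pow hα hα1 (T := T) T 1
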